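/- Let A, B, C, D ∈ Mat(L,ℂ) be the blocks of a matrix T = [[A,B],[C,D]] ∈ Mat(2L,ℂ) satisfying T*·J·T = J. Let M₊, M₋ ∈ Mat(L,ℂ) be such that D* − B*·M₊, D* + B*·M₋, D − M₊·B and D + M₋·B are invertible, and define M₊⁺ := (−C* + A*·M₊)·(D* − B*·M₊)⁻¹ and M₋⁺ := (C* + A*·M₋)·(D* + B*·M₋)⁻¹. Then Im(M₊⁺) = (D − M₊·B)⁻¹·Im(M₊)·((D − M₊·B)⁻¹)* = ((D* − B*·M₊)⁻¹)*·Im(M₊)·(D* − B*·M₊)⁻¹, and Im(M₋⁺) = (D + M₋·B)⁻¹·Im(M₋)·((D + M₋·B)⁻¹)* = ((D* + B*·M₋)⁻¹)*·Im(M₋)·(D* + B*·M₋)⁻¹. -/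

import Mathlib

open Matrix

noncomputable section

/-- The `2L × 2L` matrix `J = [[0, -1],[1, 0]]`, with index type `Fin L ⊕ Fin L`. -/
def Jmat (L : ℕ) : Matrix (Fin L ⊕ Fin L) (Fin L ⊕ Fin L) ℂ :=
  Matrix.fromBlocks 0 (-1) 1 0

/-- Imaginary part `Im(Z) = (i/2)(Z* - Z)` of a square complex matrix. -/
def matIm {n : Type*} (Z : Matrix n n ℂ) : Matrix n n ℂ :=
  (Complex.I / 2) • (Zᴴ - Z)

lemma Jmat_mul_self (L : ℕ) : Jmat L * Jmat L = -1 := by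
  simp [Jmat, Matrix.fromBlocks_multiply, ← Matrix.fromBlocks_one, Matrix.fromBlocks_neg]

lemma mul_Jmat_mul_conjTranspose {L : ℕ} {T : Matrix (Fin L ⊕ Fin L) (Fin L ⊕ Fin L) ℂ}
    (hT : Tᴴ * Jmat L * T = Jmat L) : T * Jmat L * Tᴴ = Jmat L := by
  have hleft : (-(Jmat L * Tᴴ * Jmat L)) * T = 1 := by
    rw [neg_mul, Matrix.mul_assoc, Matrix.mul_assoc, ← Matrix.mul_assoc Tᴴ, hT,
      Jmat_mul_self, neg_neg]
  have hright : T * Jmat L * Tᴴ * Jmat L = -1 := by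
    rw [← mul_eq_one_comm.mp hleft]
    noncomm_ring
  calc T * Jmat L * Tᴴ = -(T * Jmat L * Tᴴ * (Jmat L * Jmat L)) := by
        rw [Jmat_mul_self]; simp
    _ = Jmat L := by rw [← Matrix.mul_assoc, hright]; simp

lemma matIm_neg {n : Type*} (Z : Matrix n n ℂ) : matIm (-Z) = -matIm Z := by
  rw [matIm, matIm, ← smul_neg, conjTranspose_neg]
  congr 1
  abel

/-- The cross-multiplied form of `J`-unitarity, for two independent arguments of the
left and right linear fractional expressions. -/
lemma moebius_cross_sub {L : ℕ} {A B C D : Matrix (Fin L) (Fin L) ℂ}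
    (hT : (Matrix.fromBlocks A B C D)ᴴ * Jmat L * Matrix.fromBlocks A B C D = Jmat L)
    (M N : Matrix (Fin L) (Fin L) ℂ) :
    (D - M * B) * (-Cᴴ + Aᴴ * N) - (-C + M * A) * (Dᴴ - Bᴴ * N) = N - M := by
  have h := mul_Jmat_mul_conjTranspose hT
  simp only [Jmat, fromBlocks_conjTranspose, fromBlocks_multiply, fromBlocks_inj, mul_zero,
    mul_one, mul_neg, neg_mul, zero_add, add_zero] at h
  obtain ⟨h11, h12, h21, h22⟩ := h
  calc _ = (D * Aᴴ + -(C * Bᴴ)) * N + M * (B * Cᴴ + -(A * Dᴴ))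
        - (D * Cᴴ + -(C * Dᴴ)) - M * (B * Aᴴ + -(A * Bᴴ)) * N := by noncomm_ring
    _ = N - M := by rw [h11, h12, h21, h22]; noncomm_ring

lemma matIm_moebius_left {L : ℕ} {A B C D : Matrix (Fin L) (Fin L) ℂ}
    (hT : (Matrix.fromBlocks A B C D)ᴴ * Jmat L * Matrix.fromBlocks A B C D = Jmat L)
    {M : Matrix (Fin L) (Fin L) ℂ}
    (hQ : IsUnit (Dᴴ - Bᴴ * M)) (hR : IsUnit (D - M * B)) :
    matIm ((-Cᴴ + Aᴴ * M) * (Dᴴ - Bᴴ * M)⁻¹) =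
      (D - M * B)⁻¹ * matIm M * ((D - M * B)⁻¹)ᴴ := by
  have hQ' := (Matrix.isUnit_iff_isUnit_det _).mp hQ
  have hR' := (Matrix.isUnit_iff_isUnit_det _).mp hR
  have hcross := moebius_cross_sub hT M M
  rw [sub_self, sub_eq_zero] at hcross
  have hform : (-Cᴴ + Aᴴ * M) * (Dᴴ - Bᴴ * M)⁻¹ = (D - M * B)⁻¹ * (-C + M * A) := by
    rw [← Matrix.nonsing_inv_mul_cancel_left _ (-Cᴴ + Aᴴ * M) hR', hcross,
      ← Matrix.mul_assoc, Matrix.mul_nonsing_inv_cancel_right _ _ hQ']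
  have hconj := moebius_cross_sub hT M Mᴴ
  have hS : (-C + M * A)ᴴ = -Cᴴ + Aᴴ * Mᴴ := by simp
  have hRs : (D - M * B)ᴴ = Dᴴ - Bᴴ * Mᴴ := by simp
  rw [← hS, ← hRs] at hconj
  have hRinv : (D - M * B)ᴴ * ((D - M * B)⁻¹)ᴴ = 1 := by
    rw [← conjTranspose_mul, Matrix.nonsing_inv_mul _ hR', conjTranspose_one]
  rw [hform, matIm, matIm, Matrix.mul_smul, Matrix.smul_mul, ← hconj, conjTranspose_mul,
    mul_sub, sub_mul, Matrix.nonsing_inv_mul_cancel_left _ _ hR']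
  simp only [Matrix.mul_assoc, hRinv, Matrix.mul_one]

lemma matIm_moebius_right {L : ℕ} {A B C D : Matrix (Fin L) (Fin L) ℂ}
    (hT : (Matrix.fromBlocks A B C D)ᴴ * Jmat L * Matrix.fromBlocks A B C D = Jmat L)
    {M : Matrix (Fin L) (Fin L) ℂ} (hQ : IsUnit (Dᴴ - Bᴴ * M)) :
    matIm ((-Cᴴ + Aᴴ * M) * (Dᴴ - Bᴴ * M)⁻¹) =
      ((Dᴴ - Bᴴ * M)⁻¹)ᴴ * matIm M * (Dᴴ - Bᴴ * M)⁻¹ := by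
  have hQ' := (Matrix.isUnit_iff_isUnit_det _).mp hQ
  have hconj := moebius_cross_sub hT Mᴴ M
  have hP : (-Cᴴ + Aᴴ * M)ᴴ = -C + Mᴴ * A := by simp
  have hQs : (Dᴴ - Bᴴ * M)ᴴ = D - Mᴴ * B := by simp
  rw [← hP, ← hQs] at hconj
  have hQinv : ((Dᴴ - Bᴴ * M)⁻¹)ᴴ * (Dᴴ - Bᴴ * M)ᴴ = 1 := by
    rw [← conjTranspose_mul, Matrix.mul_nonsing_inv _ hQ', conjTranspose_one]
  rw [matIm, matIm, Matrix.mul_smul, Matrix.smul_mul, ← neg_sub M, ← hconj, neg_sub,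
    conjTranspose_mul, mul_sub, sub_mul, ← Matrix.mul_assoc, ← Matrix.mul_assoc, hQinv,
    Matrix.one_mul, Matrix.mul_nonsing_inv_cancel_right _ _ hQ']

/-- transformation of the imaginary part of the Weyl–Titchmarsh matrices
under the Möbius action at a jump (Corollary (vi),(vii) of the paper).  Here `Mp` plays
the role of `M₊` and `Mm` that of `M₋`, with `Mp⁺ = (−C* + A*·Mp)·(D* − B*·Mp)⁻¹` and
`Mm⁺ = (C* + A*·Mm)·(D* + B*·Mm)⁻¹`. -/
theorem moebius_imaginary_part_identity (L : ℕ) (hL : 0 < L)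
    (A B C D : Matrix (Fin L) (Fin L) ℂ)
    (hT : (Matrix.fromBlocks A B C D)ᴴ * Jmat L * Matrix.fromBlocks A B C D = Jmat L)
    (Mp Mm : Matrix (Fin L) (Fin L) ℂ)
    (h1 : IsUnit (Dᴴ - Bᴴ * Mp)) (h2 : IsUnit (Dᴴ + Bᴴ * Mm))
    (h3 : IsUnit (D - Mp * B)) (h4 : IsUnit (D + Mm * B)) :
    (matIm ((-Cᴴ + Aᴴ * Mp) * (Dᴴ - Bᴴ * Mp)⁻¹) =
        (D - Mp * B)⁻¹ * matIm Mp * ((D - Mp * B)⁻¹)ᴴ ∧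
      matIm ((-Cᴴ + Aᴴ * Mp) * (Dᴴ - Bᴴ * Mp)⁻¹) =
        ((Dᴴ - Bᴴ * Mp)⁻¹)ᴴ * matIm Mp * (Dᴴ - Bᴴ * Mp)⁻¹) ∧
    (matIm ((Cᴴ + Aᴴ * Mm) * (Dᴴ + Bᴴ * Mm)⁻¹) =
        (D + Mm * B)⁻¹ * matIm Mm * ((D + Mm * B)⁻¹)ᴴ ∧
      matIm ((Cᴴ + Aᴴ * Mm) * (Dᴴ + Bᴴ * Mm)⁻¹) =
        ((Dᴴ + Bᴴ * Mm)⁻¹)ᴴ * matIm Mm * (Dᴴ + Bᴴ * Mm)⁻¹) := by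
  have hQ : Dᴴ - Bᴴ * -Mm = Dᴴ + Bᴴ * Mm := by simp
  have hR : D - -Mm * B = D + Mm * B := by simp
  have hP : (-Cᴴ + Aᴴ * -Mm) * (Dᴴ + Bᴴ * Mm)⁻¹ =
      -((Cᴴ + Aᴴ * Mm) * (Dᴴ + Bᴴ * Mm)⁻¹) := by noncomm_ring
  have hleft := matIm_moebius_left hT (M := -Mm) (hQ ▸ h2) (hR ▸ h4)
  have hright := matIm_moebius_right hT (M := -Mm) (hQ ▸ h2)
  rw [hQ, hP, matIm_neg, matIm_neg, mul_neg, neg_mul, neg_inj] at hleft hright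
  rw [hR] at hleft
  exact ⟨⟨matIm_moebius_left hT h1 h3, matIm_moebius_right hT h1⟩, hleft, hright⟩
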